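/- arXiv:1802.01244 — 3 statements merged into one kernel-verified Lean document; each statement's English description precedes it below -/
import Mathlib

section
/- Let n ≥ 0 and 1 ≤ k ≤ n+1 be integers, and let X₁,…,X_k be independent random variables each with density f(x) = ∫₀¹ e^{−x} x^{u−1}/Γ(u) du on (0,∞) (gamma with rate 1 and shape uniform on (0,1)). Then E[(X₁+⋯+X_k)ⁿ] = (−1)ⁿ B_n^{(n−k+1)}(−k+1); that is, ∫_{(0,1)^k} ∫_{(0,∞)^k} (x₁+⋯+x_k)ⁿ ∏_{i=1}^{k} (e^{−x_i} x_i^{u_i−1}/Γ(u_i)) dx₁⋯dx_k du₁⋯du_k = (−1)ⁿ B_n^{(n−k+1)}(−k+1). -/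
open MeasureTheory Finset

/-- Stirling numbers of the second kind: `S₂(n,k) = (1/k!) ∑_{l=0}^k (−1)^{k−l} C(k,l) lⁿ`. -/
noncomputable def S2 (n k : ℕ) : ℝ :=
  (Nat.factorial k : ℝ)⁻¹ *
    ∑ l ∈ Finset.range (k + 1), (-1 : ℝ) ^ (k - l) * (k.choose l) * (l : ℝ) ^ n

/-- Higher-order Bernoulli numbers: the `k`-fold binomial convolution of the Bernoulli
numbers (with `B₁ = −1/2`). -/
noncomputable def Bhigh (k n : ℕ) : ℝ :=
  ∑ j ∈ Finset.Nat.antidiagonalTuple k n,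
    (Nat.multinomial Finset.univ j : ℝ) * ∏ i, (bernoulli (j i) : ℝ)

/-- Higher-order Bernoulli polynomials: `B_n^{(r)}(x) = ∑_{j=0}^n C(n,j) B_j^{(r)} x^{n−j}`. -/
noncomputable def BhighPoly (r n : ℕ) (x : ℝ) : ℝ :=
  ∑ j ∈ Finset.range (n + 1), (n.choose j : ℝ) * Bhigh r j * x ^ (n - j)

theorem coeff_bernoulliPowerSeries_pow (r n : ℕ) :
    PowerSeries.coeff n (bernoulliPowerSeries ℝ ^ r) = Bhigh r n / (n.factorial : ℝ) := by
  have h := PowerSeries.coeff_prod (fun _ : Fin r => bernoulliPowerSeries ℝ) n Finset.univ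
  rw [Finset.prod_const, Finset.card_univ, Fintype.card_fin] at h
  rw [h, Bhigh, Finset.sum_div]
  refine Finset.sum_bij' (fun l _ => (l : Fin r → ℕ)) (fun j _ => Finsupp.equivFunOnFinite.symm j)
    ?_ ?_ ?_ ?_ ?_
  · intro l hl
    simpa [Finset.Nat.mem_antidiagonalTuple] using hl
  · intro j hj
    simpa [Finset.Nat.mem_antidiagonalTuple] using hj
  · intro l _
    ext i
    simp
  · intro j _
    ext i
    simp
  · intro l hl
    have hs : ∑ i, l i = n := by simpa using hl
    have hm : ((∏ i, (l i).factorial : ℕ) : ℝ) * (Nat.multinomial Finset.univ (l : Fin r → ℕ) : ℝ)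
        = (n.factorial : ℝ) := by
      rw [← hs]
      exact_mod_cast Nat.multinomial_spec Finset.univ (l : Fin r → ℕ)
    have hn : (n.factorial : ℝ) ≠ 0 := by positivity
    have hp : ((∏ i, (l i).factorial : ℕ) : ℝ) ≠ 0 := by
      intro h0
      rw [h0, zero_mul] at hm
      exact hn hm.symm
    simp only [bernoulliPowerSeries, PowerSeries.coeff_mk, map_div₀, map_natCast,
      eq_ratCast, Finset.prod_div_distrib]
    rw [← Nat.cast_prod, div_eq_div_iff hp hn, ← hm]
    ring

theorem coeff_bernoulliPowerSeries_pow_mul_exp (r n : ℕ) (x : ℝ) :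
    PowerSeries.coeff n (bernoulliPowerSeries ℝ ^ r * PowerSeries.rescale x (PowerSeries.exp ℝ))
      = BhighPoly r n x / (n.factorial : ℝ) := by
  rw [PowerSeries.coeff_mul, Finset.Nat.sum_antidiagonal_eq_sum_range_succ_mk, BhighPoly,
    Finset.sum_div]
  refine Finset.sum_congr rfl fun j hj => ?_
  have hj' : j ≤ n := Nat.lt_succ_iff.mp (Finset.mem_range.mp hj)
  rw [coeff_bernoulliPowerSeries_pow, PowerSeries.coeff_rescale, PowerSeries.coeff_exp,
    Nat.cast_choose ℝ hj']
  have := Nat.factorial_ne_zero n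
  simp only [one_div, map_inv₀, map_natCast]
  field_simp

theorem BhighPoly_order_zero (n : ℕ) (x : ℝ) : BhighPoly 0 n x = x ^ n := by
  have h := coeff_bernoulliPowerSeries_pow_mul_exp 0 n x
  rw [pow_zero, one_mul, PowerSeries.coeff_rescale, PowerSeries.coeff_exp] at h
  have := Nat.factorial_ne_zero n
  simp only [one_div, map_inv₀, map_natCast] at h
  field_simp at h
  exact h.symm

theorem BhighPoly_degree_zero (r : ℕ) (x : ℝ) : BhighPoly r 0 x = 1 := by
  simp [BhighPoly, Bhigh, Finset.Nat.antidiagonalTuple_zero_right, Nat.multinomial]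

/-- The forward difference of a higher-order Bernoulli polynomial. -/
theorem BhighPoly_add_one_sub (r n : ℕ) (x : ℝ) :
    BhighPoly (r + 1) (n + 1) (x + 1) - BhighPoly (r + 1) (n + 1) x
      = (n + 1) * BhighPoly r n x := by
  have key : bernoulliPowerSeries ℝ ^ (r + 1) * PowerSeries.rescale (x + 1) (PowerSeries.exp ℝ)
      - bernoulliPowerSeries ℝ ^ (r + 1) * PowerSeries.rescale x (PowerSeries.exp ℝ)
      = PowerSeries.X *
        (bernoulliPowerSeries ℝ ^ r * PowerSeries.rescale x (PowerSeries.exp ℝ)) := by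
    rw [← PowerSeries.exp_mul_exp_eq_exp_add, PowerSeries.rescale_one, RingHom.id_apply]
    linear_combination (bernoulliPowerSeries ℝ ^ r * PowerSeries.rescale x (PowerSeries.exp ℝ)) *
      bernoulliPowerSeries_mul_exp_sub_one ℝ
  have h := congrArg (PowerSeries.coeff (n + 1)) key
  rw [map_sub, PowerSeries.coeff_succ_X_mul] at h
  simp only [coeff_bernoulliPowerSeries_pow_mul_exp] at h
  rw [Nat.factorial_succ, Nat.cast_mul] at h
  have := Nat.factorial_ne_zero n
  push_cast at h
  field_simp at h
  linarith

theorem derivative_rescale_exp (x : ℝ) :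
    PowerSeries.derivative ℝ (PowerSeries.rescale x (PowerSeries.exp ℝ))
      = PowerSeries.C x * PowerSeries.rescale x (PowerSeries.exp ℝ) := by
  ext n
  rw [PowerSeries.coeff_derivative, PowerSeries.coeff_C_mul, PowerSeries.coeff_rescale,
    PowerSeries.coeff_rescale, PowerSeries.coeff_exp, PowerSeries.coeff_exp, Nat.factorial_succ]
  have := Nat.factorial_ne_zero n
  simp only [one_div, map_inv₀, map_natCast]
  push_cast
  field_simp
  ring

theorem X_mul_derivative_bernoulliPowerSeries :
    PowerSeries.X * PowerSeries.derivative ℝ (bernoulliPowerSeries ℝ)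
      = bernoulliPowerSeries ℝ - PowerSeries.X * bernoulliPowerSeries ℝ
        - bernoulliPowerSeries ℝ ^ 2 := by
  have h := bernoulliPowerSeries_mul_exp_sub_one ℝ
  have h' := congrArg (PowerSeries.derivative ℝ) h
  rw [Derivation.leibniz, map_sub, PowerSeries.derivative_exp, PowerSeries.derivative_one,
    PowerSeries.derivative_X, smul_eq_mul, smul_eq_mul] at h'
  linear_combination bernoulliPowerSeries ℝ * h' -
    (PowerSeries.derivative ℝ (bernoulliPowerSeries ℝ) + bernoulliPowerSeries ℝ) * h

/-- The recurrence raising order and degree of the diagonal Bernoulli polynomials. -/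
theorem BhighPoly_diag_succ (n : ℕ) (x : ℝ) :
    BhighPoly (n + 2) (n + 1) x = (x - (n + 1)) * BhighPoly (n + 1) n x := by
  set G := bernoulliPowerSeries ℝ with hG
  set E := PowerSeries.rescale x (PowerSeries.exp ℝ) with hE
  have hder : PowerSeries.X * PowerSeries.derivative ℝ (G ^ (n + 1) * E)
      = ((n + 1 : ℕ) : PowerSeries ℝ) * (G ^ (n + 1) * E - PowerSeries.X * (G ^ (n + 1) * E)
        - G ^ (n + 2) * E) + PowerSeries.C x * (PowerSeries.X * (G ^ (n + 1) * E)) := by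
    rw [Derivation.leibniz, PowerSeries.derivative_pow, derivative_rescale_exp, smul_eq_mul,
      smul_eq_mul, Nat.add_sub_cancel]
    linear_combination ((n + 1 : ℕ) : PowerSeries ℝ) * G ^ n * E *
      X_mul_derivative_bernoulliPowerSeries
  have h := congrArg (PowerSeries.coeff (n + 1)) hder
  rw [← map_natCast (PowerSeries.C (R := ℝ)), map_add, PowerSeries.coeff_C_mul,
    PowerSeries.coeff_C_mul, map_sub, map_sub, PowerSeries.coeff_succ_X_mul,
    PowerSeries.coeff_succ_X_mul, PowerSeries.coeff_derivative] at h
  simp only [hG, hE, coeff_bernoulliPowerSeries_pow_mul_exp] at h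
  rw [Nat.factorial_succ, Nat.cast_mul] at h
  have := Nat.factorial_ne_zero n
  push_cast at h
  field_simp at h
  linear_combination h

theorem neg_one_pow_mul_BhighPoly_diag (n : ℕ) (x : ℝ) :
    (-1) ^ n * BhighPoly (n + 1) n (1 - x) = (ascPochhammer ℝ n).eval x := by
  induction n with
  | zero => simp [BhighPoly_degree_zero]
  | succ n ih =>
    rw [BhighPoly_diag_succ, ascPochhammer_succ_eval, ← ih]
    ring

theorem hasDerivAt_BhighPoly (r n : ℕ) (x : ℝ) :
    HasDerivAt (BhighPoly r (n + 1)) ((n + 1) * BhighPoly r n x) x := by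
  have h : HasDerivAt (fun y => ∑ j ∈ Finset.range (n + 1 + 1),
      ((n + 1).choose j : ℝ) * Bhigh r j * y ^ (n + 1 - j))
      (∑ j ∈ Finset.range (n + 1 + 1), ((n + 1).choose j : ℝ) * Bhigh r j *
        (((n + 1 - j : ℕ) : ℝ) * x ^ (n + 1 - j - 1))) x :=
    HasDerivAt.fun_sum fun j _ => (hasDerivAt_pow _ x).const_mul _
  refine h.congr_deriv ?_
  rw [Finset.sum_range_succ, Nat.sub_self, Nat.cast_zero, zero_mul, mul_zero, add_zero,
    BhighPoly, Finset.mul_sum]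
  refine Finset.sum_congr rfl fun j _ => ?_
  have hc : (n.choose j : ℝ) * (n + 1) = ((n + 1).choose j : ℝ) * ((n + 1 - j : ℕ) : ℝ) := by
    exact_mod_cast Nat.choose_mul_succ_eq n j
  rw [show n + 1 - j - 1 = n - j by omega]
  linear_combination (-(Bhigh r j * x ^ (n - j))) * hc

theorem continuous_BhighPoly (r n : ℕ) : Continuous (BhighPoly r n) := by
  unfold BhighPoly
  fun_prop

/-- Averaging over the unit interval lowers the order. -/
theorem integral_BhighPoly_sub (r n : ℕ) (y : ℝ) :
    ∫ u in Set.Ioo (0 : ℝ) 1, BhighPoly (r + 1) n (y - u) = BhighPoly r n (y - 1) := by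
  have h1 : (n : ℝ) + 1 ≠ 0 := by positivity
  have hd : ∀ u ∈ Set.uIcc (0 : ℝ) 1,
      HasDerivAt (fun u => -(BhighPoly (r + 1) (n + 1) (y - u) / (n + 1)))
        (BhighPoly (r + 1) n (y - u)) u := fun u _ => by
    refine (((hasDerivAt_BhighPoly (r + 1) n (y - u)).comp u
      ((hasDerivAt_id u).const_sub y)).div_const ((n : ℝ) + 1)).neg.congr_deriv ?_
    field_simp
  have hc : Continuous fun u => BhighPoly (r + 1) n (y - u) :=
    (continuous_BhighPoly _ _).comp (by fun_prop)
  rw [← integral_Ioc_eq_integral_Ioo, ← intervalIntegral.integral_of_le zero_le_one,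
    intervalIntegral.integral_eq_sub_of_hasDerivAt hd (hc.intervalIntegrable _ _)]
  have h := BhighPoly_add_one_sub r n (y - 1)
  rw [sub_add_cancel] at h
  rw [sub_zero, neg_sub_neg, ← sub_div, h]
  field_simp

theorem integral_pi_BhighPoly_sub_sum (k s n : ℕ) (y : ℝ) :
    ∫ u in Set.univ.pi (fun _ : Fin k => Set.Ioo (0 : ℝ) 1), BhighPoly (s + k) n (y - ∑ i, u i)
      = BhighPoly s n (y - k) := by
  rw [volume_pi, Measure.restrict_pi_pi]
  set μ : Measure ℝ := volume.restrict (Set.Ioo (0 : ℝ) 1) with hμ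
  induction k generalizing y with
  | zero => simp [measureReal_def]
  | succ k ih =>
    have hmp := measurePreserving_piFinSuccAbove (fun _ : Fin (k + 1) => μ) 0
    have hint : Integrable (fun p : ℝ × (Fin k → ℝ) =>
        BhighPoly (s + (k + 1)) n (y - (p.1 + ∑ i, p.2 i)))
        (μ.prod (Measure.pi fun _ : Fin k => μ)) := by
      rw [hμ, ← Measure.restrict_pi_pi, Measure.prod_restrict]
      have hcont : Continuous (fun p : ℝ × (Fin k → ℝ) =>
          BhighPoly (s + (k + 1)) n (y - (p.1 + ∑ i, p.2 i))) :=
        (continuous_BhighPoly _ _).comp (by fun_prop)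
      have hK : IsCompact (Set.Icc (0 : ℝ) 1 ×ˢ
          Set.univ.pi (fun _ : Fin k => Set.Icc (0 : ℝ) 1)) :=
        isCompact_Icc.prod (isCompact_univ_pi fun _ => isCompact_Icc)
      exact (hcont.continuousOn.integrableOn_compact hK).mono_set
        (Set.prod_mono Set.Ioo_subset_Icc_self
          (Set.pi_mono fun _ _ => Set.Ioo_subset_Icc_self))
    have hstep := hmp.integral_comp' (fun p : ℝ × (Fin k → ℝ) =>
        BhighPoly (s + (k + 1)) n (y - (p.1 + ∑ i, p.2 i)))
    have hsum : ∀ u : Fin (k + 1) → ℝ,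
        ((MeasurableEquiv.piFinSuccAbove (fun _ => ℝ) 0 u).1
          + ∑ i, (MeasurableEquiv.piFinSuccAbove (fun _ => ℝ) 0 u).2 i) = ∑ i, u i := fun u => by
      simp [Fin.sum_univ_succ, MeasurableEquiv.piFinSuccAbove, Fin.insertNthEquiv, Fin.tail]
    simp only [hsum] at hstep
    rw [hstep, integral_prod_symm _ hint]
    have hinner : ∀ v : Fin k → ℝ,
        ∫ u, BhighPoly (s + (k + 1)) n (y - (u + ∑ i, v i)) ∂μ
          = BhighPoly (s + k) n ((y - 1) - ∑ i, v i) := fun v => by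
      have h := integral_BhighPoly_sub (s + k) n (y - ∑ i, v i)
      rw [show y - ∑ i, v i - 1 = y - 1 - ∑ i, v i by ring] at h
      rw [← h]
      refine integral_congr_ae (Filter.Eventually.of_forall fun u => ?_)
      simp only [← add_assoc]
      congr 1
      ring
    simp only [hinner]
    rw [ih]
    congr 1
    push_cast
    ring

/-- The moments of a sum of independent gamma variables with shapes `a i` and rate `1` are finite
and given by rising factorials of the total shape. -/
theorem integral_pi_sum_pow_mul_gamma {ι : Type*} [Fintype ι] (n : ℕ) (a : ι → ℝ)
    (ha : ∀ i, 0 < a i) :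
    IntegrableOn (fun x : ι → ℝ => (∑ i, x i) ^ n *
        ∏ i, (Real.exp (-x i) * (x i) ^ (a i - 1) / Real.Gamma (a i)))
        (Set.univ.pi fun _ : ι => Set.Ioi (0 : ℝ)) ∧
    ∫ x in Set.univ.pi (fun _ : ι => Set.Ioi (0 : ℝ)), (∑ i, x i) ^ n *
        ∏ i, (Real.exp (-x i) * (x i) ^ (a i - 1) / Real.Gamma (a i))
      = (ascPochhammer ℝ n).eval (∑ i, a i) := by
  classical
  induction n generalizing a with
  | zero =>
    simp only [pow_zero, one_mul, IntegrableOn, volume_pi, Measure.restrict_pi_pi,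
      ascPochhammer_zero, Polynomial.eval_one]
    constructor
    · exact Integrable.fintype_prod
        (f := fun i (t : ℝ) => Real.exp (-t) * t ^ (a i - 1) / Real.Gamma (a i))
        fun i => (Real.GammaIntegral_convergent (ha i)).div_const _
    · rw [integral_fintype_prod_eq_prod
        (f := fun i (t : ℝ) => Real.exp (-t) * t ^ (a i - 1) / Real.Gamma (a i))]
      refine Finset.prod_eq_one fun i _ => ?_
      rw [integral_div, ← Real.Gamma_eq_integral (ha i), div_self (Real.Gamma_pos_of_pos (ha i)).ne']
  | succ n ih =>
    have hb : ∀ i j, 0 < (a + Pi.single i 1 : ι → ℝ) j := fun i j => by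
      have := ha j
      by_cases h : j = i
      · subst h
        simp only [Pi.add_apply, Pi.single_eq_same]
        positivity
      · simpa [Pi.single_eq_of_ne h] using this
    have hms : MeasurableSet (Set.univ.pi fun _ : ι => Set.Ioi (0 : ℝ)) :=
      MeasurableSet.univ_pi fun _ => measurableSet_Ioi
    have hshift : Set.EqOn
        (fun x : ι → ℝ => ∑ i, a i * ((∑ j, x j) ^ n * ∏ j, (Real.exp (-x j) *
          (x j) ^ ((a + Pi.single i 1 : ι → ℝ) j - 1) / Real.Gamma ((a + Pi.single i 1 : ι → ℝ) j))))
        (fun x : ι → ℝ => (∑ i, x i) ^ (n + 1) *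
          ∏ i, (Real.exp (-x i) * (x i) ^ (a i - 1) / Real.Gamma (a i)))
        (Set.univ.pi fun _ : ι => Set.Ioi (0 : ℝ)) := fun x hx => by
      have hterm : ∀ i, a i * ∏ j, (Real.exp (-x j) *
          (x j) ^ ((a + Pi.single i 1 : ι → ℝ) j - 1) / Real.Gamma ((a + Pi.single i 1 : ι → ℝ) j))
          = x i * ∏ j, (Real.exp (-x j) * (x j) ^ (a j - 1) / Real.Gamma (a j)) := fun i => by
        have hxi : 0 < x i := hx i (Set.mem_univ i)
        have hrest : ∏ j ∈ {i}ᶜ, (Real.exp (-x j) *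
            (x j) ^ ((a + Pi.single i 1 : ι → ℝ) j - 1) / Real.Gamma ((a + Pi.single i 1 : ι → ℝ) j))
            = ∏ j ∈ {i}ᶜ, (Real.exp (-x j) * (x j) ^ (a j - 1) / Real.Gamma (a j)) :=
          Finset.prod_congr rfl fun j hj => by
            have hji : j ≠ i := by simpa using hj
            simp [Pi.single_eq_of_ne hji]
        rw [Fintype.prod_eq_mul_prod_compl i, Fintype.prod_eq_mul_prod_compl i, hrest,
          Pi.add_apply, Pi.single_eq_same, Real.Gamma_add_one (ha i).ne', add_sub_right_comm,
          Real.rpow_add_one hxi.ne']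
        have := (ha i).ne'
        have := (Real.Gamma_pos_of_pos (ha i)).ne'
        field_simp
      simp only [mul_left_comm (a _), hterm]
      rw [← Finset.mul_sum, ← Finset.sum_mul, pow_succ, mul_assoc]
    have hint : ∀ i ∈ Finset.univ, Integrable (fun x : ι → ℝ => a i * ((∑ j, x j) ^ n *
        ∏ j, (Real.exp (-x j) * (x j) ^ ((a + Pi.single i 1 : ι → ℝ) j - 1) /
          Real.Gamma ((a + Pi.single i 1 : ι → ℝ) j))))
        (volume.restrict (Set.univ.pi fun _ : ι => Set.Ioi (0 : ℝ))) :=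
      fun i _ => ((ih _ (hb i)).1).const_mul _
    constructor
    · exact IntegrableOn.congr_fun (integrable_finsetSum _ hint) hshift hms
    · rw [← setIntegral_congr_fun hms hshift, integral_finsetSum _ hint]
      have hsum : ∀ i, ∑ j, (a + Pi.single i 1 : ι → ℝ) j = ∑ j, a j + 1 := fun i => by
        simp [Finset.sum_add_distrib]
      simp only [integral_const_mul, fun i => (ih _ (hb i)).2, hsum]
      rw [← Finset.sum_mul, ascPochhammer_succ_left]
      simp

/-- For `n ≥ 0` and `1 ≤ k ≤ n+1`, with `X₁,…,X_k` independent, each with density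
`∫₀¹ e^{−x} x^{u−1}/Γ(u) du` on `(0,∞)` (gamma with rate 1, shape uniform on `(0,1)`):
`E[(X₁+⋯+X_k)ⁿ] = (−1)ⁿ B_n^{(n−k+1)}(−k+1)`. -/
theorem stmt5 (n k : ℕ) (hk : 1 ≤ k) (hkn : k ≤ n + 1) :
    (∫ u in Set.univ.pi (fun _ : Fin k => Set.Ioo (0 : ℝ) 1),
        ∫ x in Set.univ.pi (fun _ : Fin k => Set.Ioi (0 : ℝ)),
          (∑ i, x i) ^ n * ∏ i, (Real.exp (-x i) * (x i) ^ (u i - 1) / Real.Gamma (u i)))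
      = (-1) ^ n * BhighPoly (n + 1 - k) n (1 - k) := by
  have hms : MeasurableSet (Set.univ.pi fun _ : Fin k => Set.Ioo (0 : ℝ) 1) :=
    MeasurableSet.univ_pi fun _ => measurableSet_Ioo
  have h := integral_pi_BhighPoly_sub_sum k (n + 1 - k) n 1
  rw [Nat.sub_add_cancel hkn] at h
  rw [← h, ← integral_const_mul]
  refine setIntegral_congr_fun hms fun u hu => ?_
  simp only [neg_one_pow_mul_BhighPoly_diag]
  exact (integral_pi_sum_pow_mul_gamma n u fun i => (hu i (Set.mem_univ i)).1).2
end

section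
/- Let λ ∈ ℝ and let n ≥ k−1 with k ≥ 1 be integers. Then S_{2,λ}(n+1,k) + nλ·S_{2,λ}(n,k) = ∑_{m=k−1}^{n} C(m,k−1) · S_{1,λ}(n,m) · ∫_{(0,1)^{k−1}} (u₁+⋯+u_{k−1}+1)^{m−k+1} du₁⋯du_{k−1}, where the integral is the moment E[(U₁+⋯+U_{k−1}+1)^{m−k+1}] for independent uniform random variables U₁,…,U_{k−1} on (0,1). -/
open MeasureTheory Finset

/-- Degenerate Stirling numbers of the first kind: coefficients of
`x(x−λ)(x−2λ)⋯(x−(n−1)λ) = ∑_{k=0}^n S_{1,λ}(n,k) x^k`. -/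
noncomputable def S1deg (lam : ℝ) (n k : ℕ) : ℝ :=
  (∏ i ∈ Finset.range n, (Polynomial.X - Polynomial.C ((i : ℝ) * lam))).coeff k

/-- (Signed) Stirling numbers of the first kind. -/
noncomputable def S1 (n k : ℕ) : ℝ := S1deg 1 n k

/-- Degenerate Stirling numbers of the second kind:
`S_{2,λ}(n,k) = ∑_{m=k}^n λ^{n−m} S₁(n,m) S₂(m,k)`. -/
noncomputable def S2deg (lam : ℝ) (n k : ℕ) : ℝ :=
  ∑ m ∈ Finset.Icc k n, lam ^ (n - m) * S1 n m * S2 m k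

lemma S1deg_eq_zero_of_lt (lam : ℝ) {n m : ℕ} (h : n < m) : S1deg lam n m = 0 := by
  refine Polynomial.coeff_eq_zero_of_natDegree_lt ?_
  rwa [Polynomial.natDegree_prod_of_monic _ _ fun i _ => Polynomial.monic_X_sub_C _,
    sum_congr rfl fun i _ => Polynomial.natDegree_X_sub_C _, sum_const, card_range, smul_eq_mul,
    mul_one]

lemma S1deg_succ_zero (lam : ℝ) (n : ℕ) :
    S1deg lam (n + 1) 0 = -(n * lam * S1deg lam n 0) := by
  simp only [S1deg]
  rw [prod_range_succ, mul_sub, Polynomial.coeff_sub, Polynomial.coeff_mul_X_zero,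
    Polynomial.coeff_mul_C]
  ring

lemma S1deg_succ_succ (lam : ℝ) (n m : ℕ) :
    S1deg lam (n + 1) (m + 1) = S1deg lam n m - n * lam * S1deg lam n (m + 1) := by
  simp only [S1deg]
  rw [prod_range_succ, mul_sub, Polynomial.coeff_sub, Polynomial.coeff_mul_X,
    Polynomial.coeff_mul_C]
  ring

lemma pow_mul_S1 (lam : ℝ) {n m : ℕ} (h : m ≤ n) :
    lam ^ (n - m) * S1 n m = S1deg lam n m := by
  induction n generalizing m with
  | zero =>
    obtain rfl : m = 0 := by omega
    simp [S1, S1deg]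
  | succ n ih =>
    unfold S1 at ih ⊢
    cases m with
    | zero =>
      rw [S1deg_succ_zero, S1deg_succ_zero, ← ih (Nat.zero_le n)]
      simp only [Nat.sub_zero]
      ring
    | succ m =>
      rw [S1deg_succ_succ, S1deg_succ_succ, ← ih (Nat.le_of_succ_le_succ h),
        Nat.add_sub_add_right]
      rcases Nat.lt_or_ge m n with hm | hm
      · rw [← ih hm, show n - m = n - (m + 1) + 1 by omega]
        ring
      · rw [S1deg_eq_zero_of_lt 1 (Nat.lt_succ_of_le hm),
          S1deg_eq_zero_of_lt lam (Nat.lt_succ_of_le hm)]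
        ring

lemma S2_eq_fwdDiff (n k : ℕ) :
    S2 n k = (k.factorial : ℝ)⁻¹ * (fwdDiff (1 : ℝ))^[k] (fun x => x ^ n) 0 := by
  simp [S2, fwdDiff_iter_eq_sum_shift]

lemma S2_eq_zero_of_lt {n k : ℕ} (h : n < k) : S2 n k = 0 := by
  rw [S2_eq_fwdDiff, fwdDiff_iter_pow_eq_zero_of_lt h]
  simp

lemma S2_succ_succ_eq_fwdDiff (m j : ℕ) :
    S2 (m + 1) (j + 1) =
      (j.factorial : ℝ)⁻¹ * (fwdDiff (1 : ℝ))^[j] (fun x => x ^ m) 1 := by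
  rw [S2, fwdDiff_iter_eq_sum_shift, sum_range_succ', mul_sum, mul_add, mul_sum]
  simp only [Nat.cast_zero, ne_eq, Nat.add_eq_zero_iff, one_ne_zero, and_false, not_false_eq_true,
    zero_pow, mul_zero, add_zero]
  refine sum_congr rfl fun l _ => ?_
  have hc : ((j + 1).choose (l + 1) : ℝ) * (l + 1) = (j + 1) * j.choose l := by
    exact_mod_cast (Nat.add_one_mul_choose_eq j l).symm
  rw [Nat.factorial_succ, Nat.add_sub_add_right]
  simp only [zsmul_eq_mul, nsmul_eq_mul, Int.cast_mul, Int.cast_pow, Int.cast_neg, Int.cast_one,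
    Int.cast_natCast, Nat.cast_mul, Nat.cast_add, Nat.cast_one, mul_one]
  rw [pow_succ]
  have hf : (j.factorial : ℝ) ≠ 0 := by positivity
  have hj : (j : ℝ) + 1 ≠ 0 := by positivity
  rw [add_comm (1 : ℝ) l]
  field_simp
  exact hc

lemma S2deg_eq_sum_range (lam : ℝ) (n k : ℕ) :
    S2deg lam n k = ∑ m ∈ range (n + 1), S1deg lam n m * S2 m k := by
  rw [S2deg]
  have : ∀ m ∈ Icc k n, lam ^ (n - m) * S1 n m * S2 m k = S1deg lam n m * S2 m k := fun m hm => by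
    rw [pow_mul_S1 lam (mem_Icc.1 hm).2]
  rw [sum_congr rfl this]
  refine sum_subset (fun m hm => ?_) fun m hm hm' => ?_
  · simp only [mem_Icc, mem_range] at *
    omega
  · simp only [mem_Icc, mem_range] at *
    rw [S2_eq_zero_of_lt (by omega), mul_zero]

lemma S2deg_succ_add (lam : ℝ) (n k : ℕ) :
    S2deg lam (n + 1) k + n * lam * S2deg lam n k =
      ∑ m ∈ range (n + 1), S1deg lam n m * S2 (m + 1) k := by
  have h : ∑ m ∈ range (n + 1), S1deg lam n m * S2 m k =
      ∑ m ∈ range (n + 1), S1deg lam n (m + 1) * S2 (m + 1) k + S1deg lam n 0 * S2 0 k := by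
    rw [← sum_range_succ' (fun m => S1deg lam n m * S2 m k),
      sum_range_succ _ (n + 1), S1deg_eq_zero_of_lt lam (Nat.lt_succ_self n)]
    ring
  rw [S2deg_eq_sum_range, S2deg_eq_sum_range, h, sum_range_succ']
  simp only [S1deg_succ_succ, S1deg_succ_zero, sub_mul, sum_sub_distrib, mul_add, mul_sum, mul_assoc]
  ring

lemma integrableOn_pi_Ioo_of_continuous {j : ℕ} {f : (Fin j → ℝ) → ℝ} (hf : Continuous f) :
    IntegrableOn f (Set.univ.pi fun _ => Set.Ioo (0 : ℝ) 1) :=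
  (hf.continuousOn.integrableOn_compact (isCompact_univ_pi fun _ => isCompact_Icc)).mono_set
    (Set.pi_mono fun _ _ => Set.Ioo_subset_Icc_self)

lemma setIntegral_pi_Ioo_succ {j : ℕ} {f : (Fin (j + 1) → ℝ) → ℝ} (hf : Continuous f) :
    ∫ u in Set.univ.pi (fun _ : Fin (j + 1) => Set.Ioo (0 : ℝ) 1), f u =
      ∫ v in Set.univ.pi (fun _ : Fin j => Set.Ioo (0 : ℝ) 1),
        ∫ t in (0 : ℝ)..1, f (Fin.cons t v) := by
  have hint := integrableOn_pi_Ioo_of_continuous hf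
  simp only [IntegrableOn, volume_pi, Measure.restrict_pi_pi] at hint ⊢
  have hmp := (measurePreserving_piFinSuccAbove
    (fun _ : Fin (j + 1) => (volume : Measure ℝ).restrict (Set.Ioo 0 1)) 0).symm
  rw [← hmp.integrable_comp_emb (MeasurableEquiv.measurableEmbedding _)] at hint
  rw [← hmp.integral_comp (MeasurableEquiv.measurableEmbedding _)]
  refine (integral_prod_symm _ hint).trans ?_
  refine integral_congr_ae (.of_forall fun v => ?_)
  simp only [intervalIntegral.integral_of_le zero_le_one, integral_Ioc_eq_integral_Ioo, ← Fin.insertNth_zero']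
  rfl

lemma descFactorial_mul_setIntegral_pi_Ioo (j p : ℕ) (x : ℝ) :
    ((p + j).descFactorial j : ℝ) *
        ∫ u in Set.univ.pi (fun _ : Fin j => Set.Ioo (0 : ℝ) 1), ((∑ i, u i) + x) ^ p =
      (fwdDiff (1 : ℝ))^[j] (fun y => y ^ (p + j)) x := by
  induction j generalizing p x with
  | zero => simp [measureReal_def, volume_pi, Measure.pi_pi]
  | succ j ih =>
    rw [Function.iterate_succ_apply', fwdDiff, show p + (j + 1) = p + 1 + j by ring, ← ih, ← ih,
      ← mul_sub, ← integral_sub (integrableOn_pi_Ioo_of_continuous (by fun_prop))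
        (integrableOn_pi_Ioo_of_continuous (by fun_prop)),
      setIntegral_pi_Ioo_succ (by fun_prop), Nat.descFactorial_succ,
      show p + 1 + j - j = p + 1 by omega, Nat.cast_mul, mul_comm ((p + 1 : ℕ) : ℝ), mul_assoc,
      ← integral_const_mul]
    congr 2
    ext v
    have hp : (p : ℝ) + 1 ≠ 0 := by positivity
    simp only [Fin.sum_univ_succ, Fin.cons_zero, Fin.cons_succ, add_assoc]
    rw [intervalIntegral.integral_comp_add_right (fun y => y ^ p), integral_pow]
    push_cast
    field_simp
    ring_nf

lemma S2_succ_succ_eq_choose_mul_setIntegral {m j : ℕ} (h : j ≤ m) :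
    S2 (m + 1) (j + 1) = (m.choose j : ℝ) *
      ∫ u in Set.univ.pi (fun _ : Fin j => Set.Ioo (0 : ℝ) 1), ((∑ i, u i) + 1) ^ (m - j) := by
  have := descFactorial_mul_setIntegral_pi_Ioo j (m - j) 1
  rw [Nat.sub_add_cancel h, Nat.descFactorial_eq_factorial_mul_choose] at this
  rw [S2_succ_succ_eq_fwdDiff, ← this]
  have hf : (j.factorial : ℝ) ≠ 0 := by positivity
  push_cast
  field_simp

/-- For `k ≥ 1` and `n ≥ k−1`:
`S_{2,λ}(n+1,k) + nλ S_{2,λ}(n,k)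
  = ∑_{m=k−1}^n C(m,k−1) S_{1,λ}(n,m) E[(U₁+⋯+U_{k−1}+1)^{m−k+1}]`. -/
theorem stmt7 (lam : ℝ) (n k : ℕ) (hk : 1 ≤ k) (hn : k - 1 ≤ n) :
    S2deg lam (n + 1) k + n * lam * S2deg lam n k
      = ∑ m ∈ Finset.Icc (k - 1) n, (m.choose (k - 1) : ℝ) * S1deg lam n m *
          ∫ u in Set.univ.pi (fun _ : Fin (k - 1) => Set.Ioo (0 : ℝ) 1),
            ((∑ i, u i) + 1) ^ (m + 1 - k) := by
  obtain ⟨j, rfl⟩ : ∃ j, k = j + 1 := ⟨k - 1, by omega⟩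
  simp only [Nat.add_sub_cancel, Nat.add_sub_add_right]
  rw [S2deg_succ_add]
  symm
  refine (sum_congr rfl fun m hm => ?_).trans
    (sum_subset (s₁ := Icc j n) (fun m hm => ?_) fun m hm hm' => ?_)
  · rw [S2_succ_succ_eq_choose_mul_setIntegral (mem_Icc.1 hm).1, mul_left_comm, ← mul_assoc]
    rfl
  · simp only [mem_Icc, mem_range] at *
    omega
  · simp only [mem_Icc, mem_range] at *
    rw [S2_eq_zero_of_lt (by omega), mul_zero]
end

section
/- Let X₁,…,X_k (k ≥ 1) be independent gamma random variables each with density e^{−x} on (0,∞). Then for every integer n ≥ 0, E[(X₁+2X₂+⋯+kX_k−k)ⁿ] = ∑_{l₁+⋯+l_k=n} (n choose l₁,…,l_k) d_{l₁}(1) d_{l₂}(2) ⋯ d_{l_k}(k); that is, ∫_{(0,∞)^k} (x₁+2x₂+⋯+kx_k−k)ⁿ e^{−(x₁+⋯+x_k)} dx₁⋯dx_k = ∑_{l₁+⋯+l_k=n} (n choose l₁,…,l_k) ∏_{i=1}^{k} d_{l_i}(i). -/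
open MeasureTheory Finset

/-- Derangement polynomials: `d_n(x) = ∑_{j=0}^n (n!/(n−j)!) (−1)^{n−j} x^j`. -/
noncomputable def derPoly (n : ℕ) (x : ℝ) : ℝ :=
  ∑ j ∈ Finset.range (n + 1), (n.descFactorial j : ℝ) * (-1 : ℝ) ^ (n - j) * x ^ j

theorem integrableOn_pow_mul_exp_neg (n : ℕ) :
    IntegrableOn (fun x : ℝ => x ^ n * Real.exp (-x)) (Set.Ioi 0) := by
  have h := Real.GammaIntegral_convergent (s := (n : ℝ) + 1) (by positivity)
  simpa [mul_comm] using h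

theorem integral_pow_mul_exp_neg (n : ℕ) :
    ∫ x in Set.Ioi (0 : ℝ), x ^ n * Real.exp (-x) = n.factorial := by
  rw [← Real.Gamma_nat_eq_factorial, Real.Gamma_eq_integral (by positivity)]
  simp [mul_comm]

theorem mul_sub_one_pow_mul_exp_neg (n : ℕ) (c x : ℝ) :
    (c * x - 1) ^ n * Real.exp (-x) =
      ∑ j ∈ range (n + 1), (c ^ j * (-1) ^ (n - j) * n.choose j) * (x ^ j * Real.exp (-x)) := by
  rw [sub_eq_add_neg, add_pow, sum_mul]
  refine sum_congr rfl fun j _ => ?_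
  ring

theorem integrableOn_mul_sub_one_pow_mul_exp_neg (n : ℕ) (c : ℝ) :
    IntegrableOn (fun x : ℝ => (c * x - 1) ^ n * Real.exp (-x)) (Set.Ioi 0) := by
  simp_rw [mul_sub_one_pow_mul_exp_neg]
  exact integrable_finsetSum _ fun j _ => (integrableOn_pow_mul_exp_neg j).const_mul _

/-- `d_n(c)` is the `n`-th moment of `c X - 1` for `X` standard exponential. -/
theorem integral_mul_sub_one_pow_mul_exp_neg (n : ℕ) (c : ℝ) :
    ∫ x in Set.Ioi (0 : ℝ), (c * x - 1) ^ n * Real.exp (-x) = derPoly n c := by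
  simp_rw [mul_sub_one_pow_mul_exp_neg]
  rw [integral_finsetSum _ fun j _ => (integrableOn_pow_mul_exp_neg j).const_mul _]
  refine sum_congr rfl fun j _ => ?_
  rw [integral_const_mul, integral_pow_mul_exp_neg, Nat.descFactorial_eq_factorial_mul_choose]
  push_cast
  ring

theorem sum_sub_card_pow_mul_exp_neg (k n : ℕ) (x : Fin k → ℝ) :
    ((∑ i, ((i.val : ℝ) + 1) * x i) - k) ^ n * Real.exp (-∑ i, x i) =
      ∑ l ∈ Finset.Nat.antidiagonalTuple k n, (Nat.multinomial univ l : ℝ) *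
        ∏ i, ((((i.val : ℝ) + 1) * x i - 1) ^ l i * Real.exp (-x i)) := by
  have hs : (∑ i, ((i.val : ℝ) + 1) * x i) - k = ∑ i : Fin k, (((i.val : ℝ) + 1) * x i - 1) := by
    simp [sum_sub_distrib]
  rw [hs, sum_pow_eq_sum_piAntidiag, piAntidiag_univ_fin_eq_antidiagonalTuple,
    ← sum_neg_distrib, Real.exp_sum, sum_mul]
  simp_rw [prod_mul_distrib, mul_assoc]

/-- For `X₁,…,X_k` (`k ≥ 1`) independent gamma random variables with density `e^{−x}` on
`(0,∞)` and `n ≥ 0`: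
`E[(X₁+2X₂+⋯+kX_k−k)ⁿ] = ∑_{l₁+⋯+l_k=n} (n choose l₁,…,l_k) d_{l₁}(1)⋯d_{l_k}(k)`. -/
theorem stmt11 (k : ℕ) (hk : 1 ≤ k) (n : ℕ) :
    ∫ x in Set.univ.pi (fun _ : Fin k => Set.Ioi (0 : ℝ)),
        ((∑ i, ((i.val : ℝ) + 1) * x i) - k) ^ n * Real.exp (-∑ i, x i)
      = ∑ l ∈ Finset.Nat.antidiagonalTuple k n,
          (Nat.multinomial Finset.univ l : ℝ) * ∏ i, derPoly (l i) ((i.val : ℝ) + 1) := by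
  simp_rw [sum_sub_card_pow_mul_exp_neg]
  rw [volume_pi, Measure.restrict_pi_pi, integral_finsetSum _ fun l _ => (Integrable.fintype_prod
    (f := fun (i : Fin k) (y : ℝ) => (((i.val : ℝ) + 1) * y - 1) ^ l i * Real.exp (-y))
    fun i => (integrableOn_mul_sub_one_pow_mul_exp_neg (l i) _).integrable).const_mul _]
  refine sum_congr rfl fun l _ => ?_
  rw [integral_const_mul, integral_fintype_prod_eq_prod
    (fun (i : Fin k) (y : ℝ) => (((i.val : ℝ) + 1) * y - 1) ^ l i * Real.exp (-y))]
  simp_rw [integral_mul_sub_one_pow_mul_exp_neg]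
end
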